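/- Let M be a manifold with a locally free action of a connected abelian Lie group H with Lie algebra h of dimension k. Suppose W ⊂ Ω¹(M)^H is a subspace such that dW ⊂ Ω²_B(M) and the pairing h × W → R, (v,w) ↦ i_{X_v} w, is non-degenerate (values are constant functions). Then the H-invariant de Rham complex decomposes as Ω^*(M)^H = Ω^*_B(M) ⊗ Λ W as graded vector spaces, where Ω^*_B(M) is the complex of basic forms. -/

import Mathlib

open scoped TensorProduct

namespace ExteriorAlgebra

variable {R M : Type*} [CommRing R] [AddCommGroup M] [Module R M]

/-- Contraction of the exterior algebra by a linear form. -/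
noncomputable def contract (d : Module.Dual R M) : ExteriorAlgebra R M →ₗ[R] ExteriorAlgebra R M :=
  CliffordAlgebra.contractLeft (Q := (0 : QuadraticForm R M)) d

/-- The grade involution of the exterior algebra. -/
noncomputable def gradeInvolution : ExteriorAlgebra R M →ₐ[R] ExteriorAlgebra R M :=
  CliffordAlgebra.involute (Q := (0 : QuadraticForm R M))

theorem ι_mul_induction {P : ExteriorAlgebra R M → Prop}
    (algebraMap : ∀ r : R, P (algebraMap _ _ r))
    (add : ∀ x y, P x → P y → P (x + y)) (ι_mul : ∀ x m, P x → P (ι R m * x)) (x) : P x :=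
  CliffordAlgebra.left_induction (Q := (0 : QuadraticForm R M)) algebraMap add ι_mul x

theorem contract_ι_mul (d : Module.Dual R M) (a : M) (b : ExteriorAlgebra R M) :
    contract d (ι R a * b) = d a • b - ι R a * contract d b :=
  CliffordAlgebra.contractLeft_ι_mul d a b

theorem contract_algebraMap (d : Module.Dual R M) (r : R) :
    contract d (algebraMap R (ExteriorAlgebra R M) r) = 0 :=
  CliffordAlgebra.contractLeft_algebraMap (Q := (0 : QuadraticForm R M)) d r

theorem contract_contract (d : Module.Dual R M) (x : ExteriorAlgebra R M) :
    contract d (contract d x) = 0 :=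
  CliffordAlgebra.contractLeft_contractLeft d x

theorem contract_comm (d d' : Module.Dual R M) (x : ExteriorAlgebra R M) :
    contract d (contract d' x) = -contract d' (contract d x) :=
  CliffordAlgebra.contractLeft_comm d d' x

theorem gradeInvolution_ι (m : M) : gradeInvolution (ι R m) = -ι R m :=
  CliffordAlgebra.involute_ι m

theorem gradeInvolution_gradeInvolution (x : ExteriorAlgebra R M) :
    gradeInvolution (gradeInvolution x) = x :=
  CliffordAlgebra.involute_involute x

theorem contract_gradeInvolution (d : Module.Dual R M) (x : ExteriorAlgebra R M) :
    contract d (gradeInvolution x) = -gradeInvolution (contract d x) := by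
  induction x using ι_mul_induction with
  | algebraMap r => simp [contract_algebraMap]
  | add x y hx hy => simp only [map_add, hx, hy, neg_add]
  | ι_mul x m hx =>
    simp only [map_mul, gradeInvolution_ι, contract_ι_mul, neg_mul, map_neg, map_sub, map_smul, hx]
    simp only [mul_neg]

/-- The endomorphism induced by a rank one perturbation of the identity differs from the identity
by a contraction. -/
theorem map_id_sub_smulRight (d : Module.Dual R M) (w : M) (x : ExteriorAlgebra R M) :
    map (LinearMap.id - d.smulRight w) x = x - ι R w * contract d x := by
  induction x using ι_mul_induction with
  | algebraMap r => simp [contract_algebraMap]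
  | add x y hx hy => simp only [map_add, hx, hy, mul_add]; abel
  | ι_mul x m hx =>
    have h : ι R w * (ι R m * contract d x) = -(ι R m * (ι R w * contract d x)) := by
      rw [← mul_assoc, ← mul_assoc, eq_neg_iff_add_eq_zero, ← add_mul, ι_add_mul_swap, zero_mul]
    have h' : ι R w * (ι R w * contract d x) = 0 := by rw [← mul_assoc, ι_sq_zero, zero_mul]
    rw [map_mul, hx, map_apply_ι, contract_ι_mul]
    simp only [LinearMap.sub_apply, LinearMap.id_apply, LinearMap.smulRight_apply, map_sub,
      map_smul, sub_mul, mul_sub, smul_mul_assoc, mul_smul_comm, h, h', smul_zero]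
    abel

theorem map_zero_eq (x : ExteriorAlgebra R M) :
    map (0 : M →ₗ[R] M) x = algebraMap R _ (algebraMapInv x) := by
  have h : map (0 : M →ₗ[R] M) = (Algebra.ofId R _).comp algebraMapInv := by
    ext m
    simp [algebraMapInv]
  rw [h]; rfl

variable {B : Type*} [AddCommGroup B] [Module R B] {n : Type*} [Fintype n]

/-- A tensor killed by the contractions along a family of coordinates lies in `B ⊗ 1`. -/
theorem eq_tmul_one_of_contract_eq_zero (f : n → Module.Dual R M) (w : n → M)
    (hf : ∀ i j, i ≠ j → f i (w j) = 0) (hw : ∀ x, ∑ j, f j x • w j = x)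
    (t : B ⊗[R] ExteriorAlgebra R M) (ht : ∀ j, (contract (f j)).lTensor B t = 0) :
    ∃ b : B, t = b ⊗ₜ 1 := by
  classical
  have key : ∀ s : Finset n,
      (map (LinearMap.id - ∑ j ∈ s, (f j).smulRight (w j))).toLinearMap.lTensor B t = t := by
    intro s
    induction s using Finset.induction_on with
    | empty =>
      rw [Finset.sum_empty, sub_zero, map_id]
      exact DFunLike.congr_fun (LinearMap.lTensor_id B _) t
    | insert j s hj ih =>
      have h₁ : LinearMap.id - ∑ i ∈ insert j s, (f i).smulRight (w i) =
          (LinearMap.id - (f j).smulRight (w j)) ∘ₗ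
            (LinearMap.id - ∑ i ∈ s, (f i).smulRight (w i)) := by
        have h₀ : ∀ x, f j (∑ i ∈ s, f i x • w i) = 0 := fun x => by
          rw [map_sum]
          refine Finset.sum_eq_zero fun i hi => ?_
          rw [map_smul, hf j i (by rintro rfl; exact hj hi), smul_zero]
        ext x
        simp [Finset.sum_insert hj, LinearMap.sum_apply, h₀]
        abel
      have h₂ : (map (LinearMap.id - (f j).smulRight (w j))).toLinearMap =
          LinearMap.id - LinearMap.mulLeft R (ι R (w j)) ∘ₗ contract (f j) :=
        LinearMap.ext fun x => map_id_sub_smulRight _ _ x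
      rw [h₁, ← map_comp_map, AlgHom.comp_toLinearMap, LinearMap.lTensor_comp,
        LinearMap.comp_apply, ih, h₂, LinearMap.lTensor_sub, LinearMap.sub_apply,
        LinearMap.lTensor_comp, LinearMap.comp_apply, ht, map_zero, sub_zero,
        LinearMap.lTensor_id, LinearMap.id_apply]
  have h0 : LinearMap.id - ∑ j, (f j).smulRight (w j) = 0 := by
    ext x
    simp [LinearMap.sum_apply, hw]
  have h1 := key Finset.univ
  rw [h0] at h1
  rw [← h1]
  generalize t = t'
  induction t' using TensorProduct.induction_on with
  | zero => exact ⟨0, by simp⟩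
  | tmul b e =>
    refine ⟨algebraMapInv e • b, ?_⟩
    rw [LinearMap.lTensor_tmul, AlgHom.toLinearMap_apply, map_zero_eq,
      Algebra.algebraMap_eq_smul_one, TensorProduct.tmul_smul, TensorProduct.smul_tmul']
  | add x y hx hy =>
    obtain ⟨b, hb⟩ := hx
    obtain ⟨b', hb'⟩ := hy
    exact ⟨b + b', by rw [map_add, hb, hb', TensorProduct.add_tmul]⟩

/-- A linear map out of `B ⊗ Λ M` is injective as soon as it is injective on `B ⊗ 1` and its kernel
is stable under the contractions twisted by the grade involution. -/
theorem injective_of_twisted_contract {C : Type*} [AddCommGroup C] [Module R C]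
    (f : n → Module.Dual R M) (w : n → M)
    (hf : ∀ i j, i ≠ j → f i (w j) = 0) (hw : ∀ x, ∑ j, f j x • w j = x)
    (μ : B ⊗[R] ExteriorAlgebra R M →ₗ[R] C) (hμ : ∀ b, μ (b ⊗ₜ 1) = 0 → b = 0)
    (hker : ∀ t, μ t = 0 → ∀ j,
      μ ((gradeInvolution.toLinearMap ∘ₗ contract (f j)).lTensor B t) = 0) :
    Function.Injective μ := by
  classical
  suffices key : ∀ (s : Finset n) t, μ t = 0 →
      (∀ j ∉ s, (contract (f j)).lTensor B t = 0) → t = 0 from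
    (injective_iff_map_eq_zero μ).2 fun t ht => key Finset.univ t ht (by simp)
  intro s
  induction s using Finset.induction_on with
  | empty =>
    intro t ht h
    obtain ⟨b, rfl⟩ := eq_tmul_one_of_contract_eq_zero f w hf hw t fun j => h j (by simp)
    rw [hμ b ht, TensorProduct.zero_tmul]
  | insert j s hj ih =>
    intro t ht h
    have hanti : ∀ i, contract (f i) ∘ₗ gradeInvolution.toLinearMap ∘ₗ contract (f j) =
        gradeInvolution.toLinearMap ∘ₗ contract (f j) ∘ₗ contract (f i) := fun i =>
      LinearMap.ext fun x => by
        simp [contract_gradeInvolution, contract_comm (f i) (f j)]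
    have h0 : (gradeInvolution.toLinearMap ∘ₗ contract (f j)).lTensor B t = 0 := by
      refine ih _ (hker t ht j) fun i hi => ?_
      rw [← LinearMap.comp_apply, ← LinearMap.lTensor_comp, hanti]
      by_cases hij : i = j
      · subst hij
        have : contract (f i) ∘ₗ contract (f i) = 0 := LinearMap.ext (contract_contract _)
        simp [this]
      · rw [LinearMap.lTensor_comp, LinearMap.lTensor_comp, LinearMap.comp_apply,
          LinearMap.comp_apply, h i (by simp [hij, hi]), map_zero, map_zero]
    refine ih t ht fun i hi => ?_
    by_cases hij : i = j
    · subst hij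
      have : contract (f i) = gradeInvolution.toLinearMap ∘ₗ
          gradeInvolution.toLinearMap ∘ₗ contract (f i) :=
        LinearMap.ext fun x => by simp [gradeInvolution_gradeInvolution]
      rw [this, LinearMap.lTensor_comp, LinearMap.comp_apply, h0, map_zero]
    · exact h i (by simp [hij, hi])

end ExteriorAlgebra

namespace GradedRing

variable {R A : Type*} [CommRing R] [Ring A] [Algebra R A] (𝒜 : ℕ → Submodule R A) [GradedRing 𝒜]

/-- The parity involution of a graded algebra, equal to `(-1) ^ n` in degree `n`. -/
noncomputable def parity : A →ₗ[R] A :=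
  DirectSum.toModule R ℕ A (fun n => ((-1 : R) ^ n) • (𝒜 n).subtype) ∘ₗ
    (DirectSum.decomposeLinearEquiv 𝒜).toLinearMap

variable {𝒜}

theorem parity_of_mem {n : ℕ} {a : A} (ha : a ∈ 𝒜 n) : parity 𝒜 a = ((-1 : R) ^ n) • a := by
  lift a to 𝒜 n using ha
  simp [parity]

theorem parity_parity (a : A) : parity 𝒜 (parity 𝒜 a) = a := by
  induction a using DirectSum.Decomposition.inductionOn 𝒜 with
  | zero => simp
  | add a b ha hb => simp only [map_add, ha, hb]
  | @homogeneous n a =>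
    rw [parity_of_mem a.2, map_smul, parity_of_mem a.2, smul_smul, ← mul_pow]
    simp

theorem parity_mul_of_mem_one (a : A) {w : A} (hw : w ∈ 𝒜 1) :
    parity 𝒜 (a * w) = -(parity 𝒜 a * w) := by
  induction a using DirectSum.Decomposition.inductionOn 𝒜 with
  | zero => simp
  | add a b ha hb => simp only [map_add, add_mul, ha, hb, neg_add]
  | @homogeneous n a =>
    rw [parity_of_mem a.2, parity_of_mem (SetLike.mul_mem_graded a.2 hw), pow_succ]
    simp

/-- Interior products are odd derivations with respect to the parity involution. -/
theorem map_mul_of_odd_derivation (i : Module.End R A)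
    (hi : ∀ n, ∀ a ∈ 𝒜 n, ∀ b, i (a * b) = i a * b + ((-1 : R) ^ n) • (a * i b)) (a b : A) :
    i (a * b) = i a * b + parity 𝒜 a * i b := by
  induction a using DirectSum.Decomposition.inductionOn 𝒜 with
  | zero => simp
  | add a a' ha ha' => simp only [map_add, add_mul, ha, ha']; abel
  | @homogeneous n a => rw [hi n a a.2, parity_of_mem a.2, smul_mul_assoc]

theorem map_parity_of_degree_neg_one (i : Module.End R A)
    (hdeg : ∀ n, ∀ a ∈ 𝒜 (n + 1), i a ∈ 𝒜 n) (h0 : ∀ a ∈ 𝒜 0, i a = 0) (a : A) :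
    i (parity 𝒜 a) = -parity 𝒜 (i a) := by
  induction a using DirectSum.Decomposition.inductionOn 𝒜 with
  | zero => simp
  | add a b ha hb => simp only [map_add, ha, hb, neg_add]
  | @homogeneous n a =>
    rw [parity_of_mem a.2, map_smul]
    cases n with
    | zero => simp [h0 a a.2]
    | succ n =>
      rw [parity_of_mem (hdeg n a a.2), pow_succ]
      simp

end GradedRing

section Pairing

variable {K V W : Type*} [Field K] [AddCommGroup V] [Module K V] [FiniteDimensional K V]
  [AddCommGroup W] [Module K W]

/-- A nondegenerate pairing admits a family dual to any given basis of the left factor. -/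
theorem LinearMap.exists_dual_family {n : Type*} [Fintype n] [DecidableEq n]
    (v : Module.Basis n K V) (c : V →ₗ[K] W →ₗ[K] K)
    (h₁ : ∀ v, (∀ w, c v w = 0) → v = 0) (h₂ : ∀ w, (∀ v, c v w = 0) → w = 0) :
    ∃ w : n → W, (∀ i j, c (v i) (w j) = if i = j then 1 else 0) ∧
      ∀ x, ∑ j, c (v j) x • w j = x := by
  have hc : c.IsPerfPair := .of_injective
    ((injective_iff_map_eq_zero c).2 fun x hx => h₁ x fun w => by rw [hx]; rfl)
    ((injective_iff_map_eq_zero c.flip).2 fun x hx => h₂ x fun v => DFunLike.congr_fun hx v)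
  choose w hw using fun j => (LinearMap.IsPerfPair.bijective_right c).surjective (v.coord j)
  have hvw : ∀ i j, c (v i) (w j) = if i = j then 1 else 0 := fun i j => by
    have := DFunLike.congr_fun (hw j) (v i)
    rw [LinearMap.flip_apply] at this
    rw [this, Module.Basis.coord_apply, Module.Basis.repr_self, Finsupp.single_apply]
  refine ⟨w, hvw, fun x => (LinearMap.IsPerfPair.bijective_right c).injective (v.ext fun i => ?_)⟩
  simp [hvw]

end Pairing

section ExteriorLift

open ExteriorAlgebra GradedRing

variable {R A : Type*} [CommRing R] [Ring A] [Algebra R A] {𝒜 : ℕ → Submodule R A} [GradedRing 𝒜]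
  {W : Submodule R A} (hWsq : ∀ w : W, W.subtype w * W.subtype w = 0)

theorem parity_mul_lift (hW1 : W ≤ 𝒜 1) (a : A) (e : ExteriorAlgebra R W) :
    parity 𝒜 (a * ExteriorAlgebra.lift R ⟨W.subtype, hWsq⟩ e) =
      parity 𝒜 a * ExteriorAlgebra.lift R ⟨W.subtype, hWsq⟩ (gradeInvolution e) := by
  induction e using ι_mul_induction generalizing a with
  | algebraMap r => simp [← Algebra.commutes, ← Algebra.smul_def]
  | add x y hx hy => simp only [map_add, mul_add, hx, hy]
  | ι_mul x m hx =>
    rw [map_mul (ExteriorAlgebra.lift R _), lift_ι_apply, ← mul_assoc, hx,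
      Submodule.subtype_apply, parity_mul_of_mem_one a (hW1 m.2), map_mul gradeInvolution,
      gradeInvolution_ι, map_mul, map_neg, lift_ι_apply, Submodule.subtype_apply]
    simp [mul_assoc]

theorem map_lift_eq_lift_contract (i : Module.End R A) (f : Module.Dual R W) (hW1 : W ≤ 𝒜 1)
    (hder : ∀ a b, i (a * b) = i a * b + parity 𝒜 a * i b)
    (hi1 : i 1 = 0) (hf : ∀ w : W, i w = algebraMap R A (f w)) (e : ExteriorAlgebra R W) :
    i (ExteriorAlgebra.lift R ⟨W.subtype, hWsq⟩ e) =
      ExteriorAlgebra.lift R ⟨W.subtype, hWsq⟩ (contract f e) := by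
  induction e using ι_mul_induction with
  | algebraMap r =>
    rw [contract_algebraMap, AlgHom.commutes, Algebra.algebraMap_eq_smul_one, map_smul, hi1,
      smul_zero, map_zero]
  | add x y hx hy => simp only [map_add, hx, hy]
  | ι_mul x m hx =>
    rw [map_mul, lift_ι_apply, hder, Submodule.subtype_apply, hf, hx, parity_of_mem (hW1 m.2),
      contract_ι_mul, map_sub, map_smul, map_mul, lift_ι_apply, Submodule.subtype_apply]
    simp [sub_eq_add_neg, Algebra.smul_def]

theorem map_lift_eq_zero (D : Module.End R A) (hder : ∀ a b, D (a * b) = D a * b + a * D b)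
    (hW : ∀ w ∈ W, D w = 0) (e : ExteriorAlgebra R W) :
    D (ExteriorAlgebra.lift R ⟨W.subtype, hWsq⟩ e) = 0 := by
  have h1 : D 1 = 0 := by simpa using hder 1 1
  induction e using ι_mul_induction with
  | algebraMap r => rw [AlgHom.commutes, Algebra.algebraMap_eq_smul_one, map_smul, h1, smul_zero]
  | add x y hx hy => rw [map_add, map_add, hx, hy, add_zero]
  | ι_mul x m hx =>
    rw [map_mul, lift_ι_apply, hder, hx, Submodule.subtype_apply, hW m m.2, zero_mul, mul_zero,
      add_zero]

end ExteriorLift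

open ExteriorAlgebra GradedRing

/-- Let `M` be a manifold with a locally free action of a connected
abelian Lie group `H` with Lie algebra `h` of dimension `k`.  Suppose
`W ⊆ Ω¹(M)^H` is a subspace with `dW ⊆ Ω²_B(M)` and non-degenerate constant pairing
`h × W → ℝ`, `(v, w) ↦ i_{X_v} w`.  Then the `H`-invariant de Rham complex decomposes
as `Ω^*(M)^H = Ω^*_B(M) ⊗ ΛW`: the multiplication map
`Ω^*_B(M) ⊗ ΛW → Ω^*(M)` is injective with range the invariant forms `Ω^*(M)^H`.

The de Rham algebra is abstracted to a graded `ℝ`-algebra `A` with exterior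
differential `d`, interior products `ι v` (odd derivations of degree `-1`) and Lie
derivatives `L v` (derivations) along the fundamental vector fields of `v ∈ h`,
subject to the usual Cartan calculus identities. -/
theorem stmt_6
    {A : Type*} [Ring A] [Algebra ℝ A]
    (𝒜 : ℕ → Submodule ℝ A) [GradedRing 𝒜]
    (d : A →ₗ[ℝ] A)
    {hh : Type*} [AddCommGroup hh] [Module ℝ hh] [FiniteDimensional ℝ hh]
    (k : ℕ) (hk : Module.finrank ℝ hh = k)
    (ι L : hh →ₗ[ℝ] Module.End ℝ A)
    -- Cartan calculus
    (hι2 : ∀ v, ι v ∘ₗ ι v = 0)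
    (hanti : ∀ v u, ι v ∘ₗ ι u + ι u ∘ₗ ι v = 0)
    (hιL : ∀ v u : hh, ι v ∘ₗ L u = L u ∘ₗ ι v)
    (hcartan : ∀ v, L v = d ∘ₗ ι v + ι v ∘ₗ d)
    (hιdeg : ∀ (v : hh) (n : ℕ), ∀ a ∈ 𝒜 (n + 1), ι v a ∈ 𝒜 n)
    (hι0 : ∀ v : hh, ∀ a ∈ 𝒜 0, ι v a = 0)
    (hιder : ∀ (v : hh) (n : ℕ), ∀ a ∈ 𝒜 n, ∀ b : A,
      ι v (a * b) = ι v a * b + ((-1 : ℝ) ^ n) • (a * ι v b))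
    (hLder : ∀ (v : hh) (a b : A), L v (a * b) = L v a * b + a * L v b)
    -- the subspace `W ⊆ Ω¹(M)^H`
    (W : Submodule ℝ A) (hW1 : W ≤ 𝒜 1)
    (hWinv : ∀ w ∈ W, ∀ v : hh, L v w = 0)
    (hWsq : ∀ w ∈ W, w * w = 0)
    -- `d W ⊆ Ω²_B(M)`
    (hdW : ∀ w ∈ W, d w ∈ 𝒜 2 ∧ ∀ v : hh, ι v (d w) = 0 ∧ L v (d w) = 0)
    -- the pairing `(v, w) ↦ i_{X_v} w`, with values constant functions,
    -- is non-degenerate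
    (c : hh →ₗ[ℝ] W →ₗ[ℝ] ℝ)
    (hpair : ∀ (v : hh) (w : W), ι v (w : A) = algebraMap ℝ A (c v w))
    (hnd₁ : ∀ v : hh, (∀ w : W, c v w = 0) → v = 0)
    (hnd₂ : ∀ w : W, (∀ v : hh, c v w = 0) → w = 0) :
    let Bsc : Submodule ℝ A := ⨅ v : hh, (LinearMap.ker (ι v) ⊓ LinearMap.ker (L v))
    let Inv : Submodule ℝ A := ⨅ v : hh, LinearMap.ker (L v)
    let μ : TensorProduct ℝ ↥Bsc (ExteriorAlgebra ℝ ↥W) →ₗ[ℝ] A :=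
      TensorProduct.lift (((LinearMap.mul ℝ A).compl₂
        (ExteriorAlgebra.lift ℝ ⟨W.subtype, fun w => hWsq w w.2⟩ :
          ExteriorAlgebra ℝ ↥W →ₐ[ℝ] A).toLinearMap) ∘ₗ Bsc.subtype)
    Function.Injective μ ∧ LinearMap.range μ = Inv := by
  intro Bsc Inv μ
  classical
  have hWsq' : ∀ w : W, W.subtype w * W.subtype w = 0 := fun w => hWsq w w.2
  set φ : ExteriorAlgebra ℝ W →ₐ[ℝ] A := ExteriorAlgebra.lift ℝ ⟨W.subtype, hWsq'⟩ with hφ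
  have hμt : ∀ (b : Bsc) (e : ExteriorAlgebra ℝ W), μ (b ⊗ₜ e) = (b : A) * φ e := fun _ _ => rfl
  have hBsc : ∀ a, a ∈ Bsc ↔ ∀ v, ι v a = 0 ∧ L v a = 0 := fun a => by simp [Bsc]
  have hInv : ∀ a, a ∈ Inv ↔ ∀ v, L v a = 0 := fun a => by simp [Inv]
  have hder : ∀ v a b, ι v (a * b) = ι v a * b + parity 𝒜 a * ι v b := fun v =>
    map_mul_of_odd_derivation (ι v) (hιder v)
  have hιL' : ∀ v u a, ι v (L u a) = L u (ι v a) := fun v u a => DFunLike.congr_fun (hιL v u) a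
  have hanti' : ∀ v u a, ι v (ι u a) = -ι u (ι v a) := fun v u a =>
    eq_neg_of_add_eq_zero_left (DFunLike.congr_fun (hanti v u) a)
  have hι2' : ∀ v a, ι v (ι v a) = 0 := fun v a => DFunLike.congr_fun (hι2 v) a
  have hιpar : ∀ v a, ι v (parity 𝒜 a) = -parity 𝒜 (ι v a) := fun v =>
    map_parity_of_degree_neg_one (ι v) (hιdeg v) (hι0 v)
  let v := Module.finBasis ℝ hh
  obtain ⟨w, hvw, hw⟩ := LinearMap.exists_dual_family v c hnd₁ hnd₂
  refine ⟨?_, le_antisymm ?_ ?_⟩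
  · refine injective_of_twisted_contract (fun j => c (v j)) w
      (fun i j hij => by rw [hvw, if_neg hij]) hw μ (fun b hb => ?_) fun t ht j => ?_
    · rw [hμt, map_one, mul_one] at hb
      exact Subtype.ext hb
    · have key : μ ∘ₗ (gradeInvolution.toLinearMap ∘ₗ contract (c (v j))).lTensor Bsc =
          parity 𝒜 ∘ₗ ι (v j) ∘ₗ μ := by
        refine TensorProduct.ext' fun b e => ?_
        simp only [LinearMap.comp_apply, LinearMap.lTensor_tmul, hμt, AlgHom.toLinearMap_apply]
        rw [hder, ((hBsc b).1 b.2 _).1, zero_mul, zero_add,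
          map_lift_eq_lift_contract hWsq' (ι (v j)) (c (v j)) hW1 (hder _)
            (hι0 _ _ SetLike.GradedOne.one_mem) (hpair _), parity_mul_lift hWsq' hW1, parity_parity]
      rw [← LinearMap.comp_apply, key, LinearMap.comp_apply, LinearMap.comp_apply, ht, map_zero,
        map_zero]
  · rintro _ ⟨t, rfl⟩
    refine (hInv _).2 fun u => ?_
    induction t using TensorProduct.induction_on with
    | zero => simp
    | add x y hx hy => rw [map_add, map_add, hx, hy, add_zero]
    | tmul b e =>
      rw [hμt, hLder, ((hBsc b).1 b.2 u).2,
        map_lift_eq_zero hWsq' (L u) (hLder u) (fun w hw => hWinv w hw u), zero_mul, mul_zero,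
        add_zero]
  · have hmul : ∀ a ∈ LinearMap.range μ, ∀ x : W, a * x ∈ LinearMap.range μ := by
      rintro _ ⟨t, rfl⟩ x
      induction t using TensorProduct.induction_on with
      | zero => simp
      | add y z hy hz => rw [map_add, add_mul]; exact add_mem hy hz
      | tmul b e =>
        exact ⟨b ⊗ₜ (e * ExteriorAlgebra.ι ℝ x), by
          rw [hμt, hμt, map_mul, hφ, lift_ι_apply, mul_assoc, Submodule.subtype_apply]⟩
    -- `parity` need not commute with `L u` by degree reasons, since `d` is not assumed homogeneous
    have hparInv : ∀ j : Fin (Module.finrank ℝ hh), ∀ a ∈ Inv, parity 𝒜 a ∈ Inv := by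
      intro j a ha
      have h : parity 𝒜 a = ι (v j) (a * w j) - ι (v j) a * w j := by
        rw [hder, hpair, hvw, if_pos rfl, map_one, mul_one, add_sub_cancel_left]
      refine (hInv _).2 fun u => ?_
      rw [h, map_sub, ← hιL', hLder, hLder, ← hιL', (hInv a).1 ha, hWinv _ (w j).2]
      simp
    suffices key : ∀ (s : Finset (Fin (Module.finrank ℝ hh))), ∀ a ∈ Inv,
        (∀ i ∉ s, ι (v i) a = 0) → a ∈ LinearMap.range μ from
      fun a ha => key Finset.univ a ha (by simp)
    intro s
    induction s using Finset.induction_on with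
    | empty =>
      intro a ha h
      have hι : ι.flip a = 0 := v.ext fun i => h i (by simp)
      exact ⟨⟨a, (hBsc a).2 fun u => ⟨DFunLike.congr_fun hι u, (hInv a).1 ha u⟩⟩ ⊗ₜ 1, by
        rw [hμt, map_one, mul_one]⟩
    | insert j s hj ih =>
      intro a ha h
      set b := parity 𝒜 (ι (v j) a) with hb
      have hbInv : b ∈ Inv := hparInv j _ ((hInv _).2 fun u => by
        rw [← hιL', (hInv a).1 ha, map_zero])
      have hbι : ∀ i ∉ s, ι (v i) b = 0 := fun i hi => by
        rw [hb, hιpar]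
        by_cases hij : i = j
        · rw [hij, hι2', map_zero, neg_zero]
        · rw [hanti', h i (by simp [hij, hi])]
          simp
      have hbw : a - b * w j ∈ LinearMap.range μ := by
        refine ih _ ((hInv _).2 fun u => ?_) fun i hi => ?_
        · rw [map_sub, hLder, (hInv a).1 ha, (hInv b).1 hbInv, hWinv _ (w j).2]
          simp
        · rw [map_sub, hder, hbι i hi, hpair, hvw, hb, parity_parity]
          by_cases hij : i = j
          · simp [hij]
          · simp [hij, h i (by simp [hij, hi])]
      have := add_mem hbw (hmul b (ih b hbInv hbι) (w j))
      rwa [sub_add_cancel] at this
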